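/- Let m₀ be a locally finite measure on ℝ, let u₀ : ℝ → ℝ be Borel measurable and locally m₀-integrable, let c ≥ 0, and for x ∈ ℝ define the generalized potential F_x(y) = ∫_{[0,y)} (η + c·u₀(η) − x) dm₀(η) for y ≥ 0 and F_x(y) = −∫_{[y,0)} (η + c·u₀(η) − x) dm₀(η) for y < 0. Suppose x₁ < x₂, y₁ is a global minimizer of F_{x₁}, and y₂ is a global minimizer of F_{x₂}. If y₂ < y₁, then m₀([y₂, y₁)) = 0. -/

import Mathlib

open MeasureTheory

/-- The generalized potential with integrand `g`:
`F(y) = ∫_{[0,y)} g dm₀` for `y ≥ 0` and `F(y) = −∫_{[y,0)} g dm₀` for `y < 0`. -/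
noncomputable def genPotential (m₀ : Measure ℝ) (g : ℝ → ℝ) (y : ℝ) : ℝ :=
  if 0 ≤ y then ∫ η in Set.Ico 0 y, g η ∂m₀ else -∫ η in Set.Ico y 0, g η ∂m₀

lemma genPotential_sub (m₀ : Measure ℝ) (g : ℝ → ℝ) (hg : LocallyIntegrable g m₀)
    (a b : ℝ) (hab : a < b) :
    genPotential m₀ g b - genPotential m₀ g a = ∫ η in Set.Ico a b, g η ∂m₀ := by
  have hI : ∀ p q : ℝ, IntegrableOn g (Set.Ico p q) m₀ := fun p q =>
    (hg.integrableOn_isCompact isCompact_Icc).mono_set Set.Ico_subset_Icc_self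
  have hadd : ∀ p q r : ℝ, p ≤ q → q ≤ r → ∫ η in Set.Ico p r, g η ∂m₀
      = (∫ η in Set.Ico p q, g η ∂m₀) + ∫ η in Set.Ico q r, g η ∂m₀ := by
    intro p q r h1 h2
    rw [← Set.Ico_union_Ico_eq_Ico h1 h2]
    exact setIntegral_union (Set.Ico_disjoint_Ico_same) measurableSet_Ico (hI _ _) (hI _ _)
  unfold genPotential
  split_ifs with hb ha ha
  · rw [hadd 0 a b ha hab.le]; ring
  · rw [hadd a 0 b (not_le.1 ha).le hb]; ring
  · exact absurd (ha.trans hab.le) hb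
  · rw [hadd a b 0 hab.le (not_le.1 hb).le]; ring

/- STATEMENT 13: monotonicity of minimizers of the generalized potential in x:
if x₁ < x₂, y₁ minimizes F_{x₁} and y₂ minimizes F_{x₂}, and y₂ < y₁,
then m₀([y₂, y₁)) = 0. -/
theorem minimizers_monotone_in_x
    (m₀ : Measure ℝ) [IsLocallyFiniteMeasure m₀]
    (u₀ : ℝ → ℝ) (hu₀ : Measurable u₀) (hloc : LocallyIntegrable u₀ m₀)
    (c : ℝ) (hc : 0 ≤ c) (x₁ x₂ : ℝ) (hx : x₁ < x₂) (y₁ y₂ : ℝ)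
    (hmin₁ : ∀ y : ℝ, genPotential m₀ (fun η => η + c * u₀ η - x₁) y₁
      ≤ genPotential m₀ (fun η => η + c * u₀ η - x₁) y)
    (hmin₂ : ∀ y : ℝ, genPotential m₀ (fun η => η + c * u₀ η - x₂) y₂
      ≤ genPotential m₀ (fun η => η + c * u₀ η - x₂) y)
    (hy : y₂ < y₁) :
    m₀ (Set.Ico y₂ y₁) = 0 := by
  have hli : ∀ x : ℝ, LocallyIntegrable (fun η => η + c * u₀ η - x) m₀ := fun x =>
    ((continuous_id.locallyIntegrable).add (hloc.smul c)).sub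
      (continuous_const.locallyIntegrable)
  have h1 := genPotential_sub m₀ _ (hli x₁) y₂ y₁ hy
  have h2 := genPotential_sub m₀ _ (hli x₂) y₂ y₁ hy
  have hI : ∀ x : ℝ, IntegrableOn (fun η => η + c * u₀ η - x) (Set.Ico y₂ y₁) m₀ := fun x =>
    ((hli x).integrableOn_isCompact isCompact_Icc).mono_set Set.Ico_subset_Icc_self
  have h3 := integral_sub (hI x₁) (hI x₂)
  have h4 : (fun η => (η + c * u₀ η - x₁) - (η + c * u₀ η - x₂)) = fun _ => x₂ - x₁ := by
    funext η; ring
  rw [h4, setIntegral_const, smul_eq_mul] at h3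
  have hfin : m₀ (Set.Ico y₂ y₁) ≠ ⊤ := measure_Ico_lt_top.ne
  have h5 : m₀.real (Set.Ico y₂ y₁) * (x₂ - x₁) ≤ 0 := by
    linarith [hmin₁ y₂, hmin₂ y₁]
  have h6 : m₀.real (Set.Ico y₂ y₁) = 0 :=
    le_antisymm (nonpos_of_mul_nonpos_left h5 (sub_pos.2 hx)) measureReal_nonneg
  exact (measureReal_eq_zero_iff hfin).1 h6
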